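/- Consider the axially symmetric two-branch family (G_a(A₁),G_a(A₁)): take the state space X = (ℝ × (ℝ/2πℤ)) ⊕ (ℝ × (ℝ/2πℤ)) (two copies of a real variable z together with an angle θ on the circle of circumference 2π), parameter space U = ℝ³ with coordinates (u_r,u_z,u_θ), and F given by F(inl(z,θ),u) = z² + u_r·cos(θ − u_θ) + u_z on the first branch and F(inr(z,θ),u) = z² + u_r·cos(θ − u_θ) on the second branch. Then the Maxwell set of F equals {(u_r,u_z,u_θ) : u_r = 0} ∪ {(u_r,u_z,u_θ) : u_z = 0}. -/

import Mathlib

/-- `x` is a global minimum point of the function `F (·, u)`. -/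
def IsGlobalMinPt {X U : Type*} (F : X × U → ℝ) (u : U) (x : X) : Prop :=
  ∀ y : X, F (x, u) ≤ F (y, u)

/-- The Maxwell set of a family `F`: those parameters `u` for which `F (·, u)`
has at least two distinct global minimum points. -/
def MaxwellSet {X U : Type*} (F : X × U → ℝ) : Set U :=
  {u : U | ∃ x₁ x₂ : X, x₁ ≠ x₂ ∧ IsGlobalMinPt F u x₁ ∧ IsGlobalMinPt F u x₂}

/-- The axially symmetric two-branch family `(G_a(A₁), G_a(A₁))`: both branches
have state `(z, θ)` with `θ` an angle on the circle `ℝ/2πℤ`; the first branch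
has value `z² + u_r · cos (θ − u_θ) + u_z` and the second branch
`z² + u_r · cos (θ − u_θ)`. Parameters are `(u_r, u_z, u_θ)`. -/
noncomputable def familyGaA1GaA1 :
    ((ℝ × Real.Angle) ⊕ (ℝ × Real.Angle)) × (ℝ × ℝ × ℝ) → ℝ :=
  fun p =>
    Sum.elim
      (fun q : ℝ × Real.Angle =>
        q.1 ^ 2 + p.2.1 * Real.Angle.cos (q.2 - (p.2.2.2 : Real.Angle)) + p.2.2.1)
      (fun q : ℝ × Real.Angle =>
        q.1 ^ 2 + p.2.1 * Real.Angle.cos (q.2 - (p.2.2.2 : Real.Angle))) p.1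

theorem neg_abs_le_mul_angle_cos (r : ℝ) (α : Real.Angle) : -|r| ≤ r * α.cos := by
  have h : |r * α.cos| ≤ |r| := by
    rw [abs_mul, ← Real.Angle.cos_toReal]
    exact mul_le_of_le_one_right (abs_nonneg r) (Real.abs_cos_le_one _)
  exact (abs_le.mp h).1

theorem exists_mul_angle_cos_eq_neg_abs (r : ℝ) : ∃ α : Real.Angle, r * α.cos = -|r| := by
  rcases le_total 0 r with hr | hr
  · exact ⟨(Real.pi : ℝ), by simp [abs_of_nonneg hr]⟩
  · exact ⟨0, by simp [abs_of_nonpos hr]⟩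

theorem angle_eq_of_mul_cos_eq_neg_abs {r : ℝ} (hr : r ≠ 0) {α β : Real.Angle}
    (hα : r * α.cos = -|r|) (hβ : r * β.cos = -|r|) : α = β := by
  have hsin : ∀ γ : Real.Angle, r * γ.cos = -|r| → γ.sin = 0 := by
    intro γ hγ
    have hcos : γ.cos ^ 2 = 1 := by
      apply mul_left_cancel₀ (pow_ne_zero 2 hr)
      rw [← mul_pow, hγ, neg_sq, sq_abs, mul_one]
    have := γ.cos_sq_add_sin_sq
    exact pow_eq_zero_iff two_ne_zero |>.mp (by linarith)
  have hcos : α.cos = β.cos := mul_left_cancel₀ hr (hα.trans hβ.symm)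
  have hs : α.sin = β.sin := (hsin α hα).trans (hsin β hβ).symm
  induction α using Real.Angle.induction_on
  induction β using Real.Angle.induction_on
  exact Real.Angle.cos_sin_inj hcos hs

/-- A branch `z² + r · cos (θ − c)` has at most one point of value `≤ -|r|` when `r ≠ 0`. -/
theorem branch_minimizer_unique {r : ℝ} (hr : r ≠ 0) (c : Real.Angle) {p q : ℝ × Real.Angle}
    (hp : p.1 ^ 2 + r * (p.2 - c).cos ≤ -|r|) (hq : q.1 ^ 2 + r * (q.2 - c).cos ≤ -|r|) :
    p = q := by
  have key : ∀ x : ℝ × Real.Angle, x.1 ^ 2 + r * (x.2 - c).cos ≤ -|r| →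
      x.1 = 0 ∧ r * (x.2 - c).cos = -|r| := by
    intro x hx
    have h₁ := neg_abs_le_mul_angle_cos r (x.2 - c)
    have h₂ := sq_nonneg x.1
    exact ⟨pow_eq_zero_iff two_ne_zero |>.mp (by linarith), by linarith⟩
  obtain ⟨hp₁, hp₂⟩ := key p hp
  obtain ⟨hq₁, hq₂⟩ := key q hq
  exact Prod.ext (hp₁.trans hq₁.symm)
    (sub_left_injective (angle_eq_of_mul_cos_eq_neg_abs hr hp₂ hq₂))

theorem stmt_14 :
    MaxwellSet familyGaA1GaA1 =
      {u : ℝ × ℝ × ℝ | u.1 = 0} ∪ {u : ℝ × ℝ × ℝ | u.2.1 = 0} := by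
  ext ⟨r, uz, c⟩
  simp only [MaxwellSet, IsGlobalMinPt, familyGaA1GaA1, Set.mem_ofPred_eq, Set.mem_union]
  obtain ⟨φ, hφ⟩ := exists_mul_angle_cos_eq_neg_abs r
  constructor
  · rintro ⟨x₁, x₂, hne, h₁, h₂⟩
    by_contra! h
    obtain ⟨hr, huz⟩ := h
    have a₁ := h₁ (Sum.inl (0, φ + c))
    have b₁ := h₁ (Sum.inr (0, φ + c))
    have a₂ := h₂ (Sum.inl (0, φ + c))
    have b₂ := h₂ (Sum.inr (0, φ + c))
    rcases x₁ with p | p <;> rcases x₂ with q | q <;>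
      simp only [Sum.elim_inl, Sum.elim_inr, add_sub_cancel_right, hφ] at a₁ b₁ a₂ b₂ <;>
      have hp := neg_abs_le_mul_angle_cos r (p.2 - c) <;>
      have hq := neg_abs_le_mul_angle_cos r (q.2 - c) <;>
      have hp' := sq_nonneg p.1 <;>
      have hq' := sq_nonneg q.1
    · exact hne (congrArg _ (branch_minimizer_unique hr c (by linarith) (by linarith)))
    · exact huz (by linarith)
    · exact huz (by linarith)
    · exact hne (congrArg _ (branch_minimizer_unique hr c (by linarith) (by linarith)))
  · rintro (rfl | rfl)
    · have hπ : (0 : Real.Angle) ≠ (Real.pi : ℝ) := Real.Angle.pi_ne_zero.symm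
      rcases le_total uz 0 with h | h
      · refine ⟨Sum.inl (0, 0), Sum.inl (0, (Real.pi : ℝ)), by simpa using hπ, ?_, ?_⟩ <;>
          rintro (q | q) <;> simp only [Sum.elim_inl, Sum.elim_inr] <;>
          nlinarith [sq_nonneg q.1]
      · refine ⟨Sum.inr (0, 0), Sum.inr (0, (Real.pi : ℝ)), by simpa using hπ, ?_, ?_⟩ <;>
          rintro (q | q) <;> simp only [Sum.elim_inl, Sum.elim_inr] <;>
          nlinarith [sq_nonneg q.1]
    · refine ⟨Sum.inl (0, φ + c), Sum.inr (0, φ + c), Sum.inl_ne_inr, ?_, ?_⟩ <;>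
        rintro (q | q) <;>
        simp only [Sum.elim_inl, Sum.elim_inr, add_sub_cancel_right, hφ] <;>
        linarith [sq_nonneg q.1, neg_abs_le_mul_angle_cos r (q.2 - c)]
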